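/- Let D = B(0,R) ⊂ ℂ be the open disc of radius R > 0, let v : ℂ → ℂ be continuous and bounded on D̄, let z₀, λ ∈ ℂ, and suppose μ : D̄ → ℂ is continuous, bounded, and satisfies μ(z) = 1 + ∫_D g_{z₀}(z,ζ,λ)·v(ζ)·μ(ζ) dA(ζ) for all z ∈ D̄. Define ψ(z) = exp(λ(z−z₀)²)·μ(z). Then ψ is a weak solution of −Δψ + vψ = 0 in D: for every smooth φ : ℂ → ℂ with compact support contained in D, ∫_D ψ(z)·Δφ(z) dA(z) = ∫_D v(z)·ψ(z)·φ(z) dA(z). -/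

import Mathlib

open MeasureTheory Metric Complex Filter

noncomputable section

/-- The oscillating phase `e_{λ,z₀}(z) = exp(λ(z−z₀)² − conj λ · (conj (z−z₀))²)`. -/
def phase (lam z0 z : ℂ) : ℂ :=
  Complex.exp (lam * (z - z0) ^ 2 - (starRingEnd ℂ) lam * ((starRingEnd ℂ) (z - z0)) ^ 2)

/-- Wirtinger derivative `∂u/∂z̄ = (1/2)(∂u/∂x₁ + i ∂u/∂x₂)`. -/
def wbar (u : ℂ → ℂ) (z : ℂ) : ℂ :=
  (1 / 2 : ℂ) * (fderiv ℝ u z 1 + Complex.I * fderiv ℝ u z Complex.I)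

/-- Wirtinger derivative `∂u/∂z = (1/2)(∂u/∂x₁ − i ∂u/∂x₂)`. -/
def wz (u : ℂ → ℂ) (z : ℂ) : ℂ :=
  (1 / 2 : ℂ) * (fderiv ℝ u z 1 - Complex.I * fderiv ℝ u z Complex.I)

/-- Sup norm of `u` over a set `s`. -/
def supOn (s : Set ℂ) (u : ℂ → ℂ) : ℝ := ⨆ z ∈ s, ‖u z‖

/-- The `C¹_{z̄}(D̄)` norm, `D = B(0,R)`: `max(sup_{D̄}|u|, sup_{D̄}|∂u/∂z̄|)`. -/
def normC1 (R : ℝ) (u : ℂ → ℂ) : ℝ :=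
  max (supOn (closedBall (0:ℂ) R) u) (supOn (closedBall (0:ℂ) R) (wbar u))

/-- The Bukhgeim-type Green's kernel `g_{z₀}(z,ζ,λ)` for `D = B(0,R)`. -/
def gker (R : ℝ) (z0 lam z ζ : ℂ) : ℂ :=
  (Complex.exp (lam * (ζ - z0) ^ 2 - (starRingEnd ℂ) lam * ((starRingEnd ℂ) (ζ - z0)) ^ 2) /
      (4 * (Real.pi : ℂ) ^ 2)) *
    ∫ η in ball (0 : ℂ) R,
      Complex.exp (-(lam * (η - z0) ^ 2) + (starRingEnd ℂ) lam * ((starRingEnd ℂ) (η - z0)) ^ 2) /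
        ((z - η) * ((starRingEnd ℂ) η - (starRingEnd ℂ) ζ))

/-- The operator `g_{z₀,λ} u (z) = ∫_D g_{z₀}(z,ζ,λ) u(ζ) dA(ζ)`. -/
def gop (R : ℝ) (z0 lam : ℂ) (u : ℂ → ℂ) (z : ℂ) : ℂ :=
  ∫ ζ in ball (0 : ℂ) R, gker R z0 lam z ζ * u ζ

/-- `L^p` norm over `D = B(0,R)` with respect to the area measure. -/
def lpOn (R p : ℝ) (u : ℂ → ℂ) : ℝ :=
  (∫ z in ball (0:ℂ) R, ‖u z‖ ^ p) ^ (1 / p)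

/-- The Laplacian `Δφ = ∂²φ/∂x₁² + ∂²φ/∂x₂²` of `φ : ℂ → ℂ`. -/
def lap (φ : ℂ → ℂ) (z : ℂ) : ℂ :=
  fderiv ℝ (fun w => fderiv ℝ φ w 1) z 1 + fderiv ℝ (fun w => fderiv ℝ φ w Complex.I) z Complex.I

/-- A compactly supported function vanishes outside some ball. -/
lemma exists_radius_of_hasCompactSupport {χ : ℂ → ℂ} (hc : HasCompactSupport χ) :
    ∃ M : ℝ, ∀ z, M < ‖z‖ → z ∉ tsupport χ := by
  obtain ⟨M, hM⟩ := hc.isCompact.isBounded.exists_norm_le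
  exact ⟨M, fun z hz hmem => (hM z hmem).not_gt hz⟩

open Set in
lemma integrableOn_polar_target {F : ℝ × ℝ → ℂ} (hF : Continuous F) {M : ℝ}
    (hM : ∀ p : ℝ × ℝ, M < p.1 → F p = 0) :
    IntegrableOn F (Ioi (0 : ℝ) ×ˢ Ioo (-Real.pi) Real.pi) := by
  have h1 : IntegrableOn F (Icc (0 : ℝ) M ×ˢ Icc (-Real.pi) Real.pi) :=
    hF.continuousOn.integrableOn_compact (isCompact_Icc.prod isCompact_Icc)
  refine h1.of_forall_sdiff_eq_zero (measurableSet_Ioi.prod measurableSet_Ioo) ?_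
  rintro ⟨r, θ⟩ ⟨⟨hr, hθ⟩, hn⟩
  refine hM _ (not_le.1 fun hle => hn ⟨⟨le_of_lt hr, hle⟩, Ioo_subset_Icc_self hθ⟩)

open Set in
/-- The Cauchy–Pompeiu formula for compactly supported functions, at the origin. -/
lemma integral_wbar_div_self {χ : ℂ → ℂ} (hχ : ContDiff ℝ 1 χ) (hc : HasCompactSupport χ) :
    ∫ z, wbar χ z / z = -(Real.pi : ℂ) * χ 0 := by
  obtain ⟨M, hM⟩ := exists_radius_of_hasCompactSupport hc
  set e : ℝ → ℂ := fun θ => (Real.cos θ : ℂ) + Real.sin θ * Complex.I with he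
  have hec : Continuous e := by fun_prop
  have hen : ∀ θ, ‖e θ‖ = 1 := fun θ => by
    simp only [he]
    push_cast
    exact norm_cos_add_sin_mul_I θ
  have hed : ∀ θ, HasDerivAt e (Complex.I * e θ) θ := fun θ => by
    have h := ((Real.hasDerivAt_cos θ).ofReal_comp).add
      (((Real.hasDerivAt_sin θ).ofReal_comp).mul_const Complex.I)
    refine h.congr_deriv ?_
    simp only [he]
    push_cast
    linear_combination (-Complex.sin θ) * Complex.I_sq
  have hD : Continuous (fderiv ℝ χ) := hχ.continuous_fderiv one_ne_zero
  have hdiff : ∀ z, HasFDerivAt χ (fderiv ℝ χ z) z := fun z =>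
    (hχ.differentiable one_ne_zero z).hasFDerivAt
  have hDz : ∀ z, M < ‖z‖ → fderiv ℝ χ z = 0 := fun z hz =>
    Function.notMem_support.1 fun h => hM z hz (support_fderiv_subset ℝ h)
  set A : ℝ × ℝ → ℂ := fun p => fderiv ℝ χ (p.1 * e p.2) (e p.2) with hA
  set B : ℝ × ℝ → ℂ := fun p => fderiv ℝ χ (p.1 * e p.2) (Complex.I * e p.2) with hB
  have hnorm : ∀ p : ℝ × ℝ, M < p.1 → M < ‖(p.1 : ℂ) * e p.2‖ := fun p hp => by
    rw [norm_mul, hen, mul_one, Complex.norm_real]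
    exact hp.trans_le (le_abs_self _)
  have hAi : IntegrableOn A (Ioi (0 : ℝ) ×ˢ Ioo (-Real.pi) Real.pi) := by
    refine integrableOn_polar_target (M := M) ?_ fun p hp => ?_
    · exact (hD.comp (by fun_prop)).clm_apply (by fun_prop)
    · simp [hA, hDz _ (hnorm p hp)]
  have hBi : IntegrableOn B (Ioi (0 : ℝ) ×ˢ Ioo (-Real.pi) Real.pi) := by
    refine integrableOn_polar_target (M := M) ?_ fun p hp => ?_
    · exact (hD.comp (by fun_prop)).clm_apply (by fun_prop)
    · simp [hB, hDz _ (hnorm p hp)]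
  have hAint : ∫ p in Ioi (0 : ℝ) ×ˢ Ioo (-Real.pi) Real.pi, A p
      = -(2 * Real.pi : ℂ) * χ 0 := by
    have hin : ∀ θ : ℝ, ∫ r in Ioi (0 : ℝ), A (r, θ) = - χ 0 := fun θ => by
      have hcd : ContDiff ℝ 1 (fun r : ℝ => χ (r * e θ)) :=
        hχ.comp (Complex.ofRealCLM.contDiff.mul contDiff_const)
      have hcs : HasCompactSupport (fun r : ℝ => χ (r * e θ)) := by
        refine HasCompactSupport.of_support_subset_isCompact (isCompact_Icc (a := -M) (b := M)) ?_
        intro r hr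
        rw [mem_Icc, ← abs_le]
        by_contra! hlt
        refine hM (r * e θ) ?_ (subset_tsupport _ hr)
        rwa [norm_mul, hen, mul_one, Complex.norm_real]
      have hd : ∀ r : ℝ, deriv (fun r : ℝ => χ (r * e θ)) r = A (r, θ) := fun r => by
        have h1 : HasDerivAt (fun r : ℝ => (r : ℂ) * e θ) (e θ) r := by
          simpa using (hasDerivAt_id r).ofReal_comp.mul_const (e θ)
        exact ((hdiff _).comp_hasDerivAt r h1).deriv
      simp_rw [← hd]
      simpa using hcs.integral_Ioi_deriv_eq hcd 0
    rw [Measure.volume_eq_prod] at hAi ⊢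
    rw [← Measure.prod_restrict, integral_prod_symm _ (by rwa [Measure.prod_restrict])]
    simp_rw [hin]
    rw [setIntegral_const]
    simp only [Measure.real, Real.volume_Ioo]
    rw [ENNReal.toReal_ofReal (by linarith [Real.pi_pos])]
    rw [Complex.real_smul]
    push_cast
    ring
  have hBint : ∫ p in Ioi (0 : ℝ) ×ˢ Ioo (-Real.pi) Real.pi, B p = 0 := by
    rw [Measure.volume_eq_prod] at hBi ⊢
    rw [setIntegral_prod _ hBi]
    refine setIntegral_eq_zero_of_forall_eq_zero fun r hr => ?_
    have hr0 : (r : ℂ) ≠ 0 := by exact_mod_cast (ne_of_gt hr)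
    have hd : ∀ θ ∈ uIcc (-Real.pi) Real.pi,
        HasDerivAt (fun θ : ℝ => (r : ℂ)⁻¹ * χ (r * e θ)) (B (r, θ)) θ := fun θ _ => by
      have h1 : HasDerivAt (fun θ : ℝ => (r : ℂ) * e θ) (r • (Complex.I * e θ)) θ := by
        simpa using (hed θ).const_mul (r : ℂ)
      have h2 := ((hdiff _).comp_hasDerivAt θ h1).const_mul (r : ℂ)⁻¹
      refine h2.congr_deriv ?_
      rw [map_smul, Complex.real_smul, inv_mul_cancel_left₀ hr0]
    have hBc : Continuous fun θ : ℝ => B (r, θ) :=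
      (hD.comp (by fun_prop)).clm_apply (by fun_prop)
    rw [← integral_Ioc_eq_integral_Ioo,
      ← intervalIntegral.integral_of_le (by linarith [Real.pi_pos]),
      intervalIntegral.integral_eq_sub_of_hasDerivAt hd (hBc.intervalIntegrable _ _)]
    simp [he]
  rw [← Complex.integral_comp_polarCoord_symm]
  have hkey : ∀ p ∈ polarCoord.target,
      p.1 • (wbar χ (Complex.polarCoord.symm p) / Complex.polarCoord.symm p)
        = (1 / 2 : ℂ) * (A p + Complex.I * B p) := by
    rintro ⟨r, θ⟩ ⟨hr, -⟩
    have hr0 : (r : ℂ) ≠ 0 := by exact_mod_cast (ne_of_gt hr)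
    have hz : Complex.polarCoord.symm (r, θ) = r * e θ := by simp [he]
    have he0 : e θ ≠ 0 := fun h => by simpa [h] using hen θ
    have h1 : e θ = Real.cos θ • (1 : ℂ) + Real.sin θ • Complex.I := by simp [he]
    have h2 : Complex.I * e θ = (-Real.sin θ) • (1 : ℂ) + Real.cos θ • Complex.I := by
      simp only [he, Complex.real_smul]
      push_cast
      linear_combination (Complex.sin θ) * Complex.I_sq
    have h3 : e θ * ((Real.cos θ : ℂ) - Real.sin θ * Complex.I) = 1 := by
      simp only [he]
      push_cast
      linear_combination Complex.sin_sq_add_cos_sq (θ : ℂ) - Complex.sin θ ^ 2 * Complex.I_sq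
    rw [hz, Complex.real_smul, wbar]
    have h4 : A (r, θ) + Complex.I * B (r, θ) = ((Real.cos θ : ℂ) - Real.sin θ * Complex.I)
        * (fderiv ℝ χ (r * e θ) 1 + Complex.I * fderiv ℝ χ (r * e θ) Complex.I) := by
      simp only [hA, hB]
      rw [h2]
      generalize (r : ℂ) * e θ = w
      rw [h1, map_add, map_add, map_smul, map_smul, map_smul, map_smul]
      simp only [Complex.real_smul]
      push_cast
      linear_combination (Complex.sin θ * fderiv ℝ χ w Complex.I) * Complex.I_sq
    rw [h4]
    field_simp
    linear_combination (-(fderiv ℝ χ (r * e θ) 1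
      + Complex.I * fderiv ℝ χ (r * e θ) Complex.I)) * h3
  have hm : MeasurableSet polarCoord.target := polarCoord.open_target.measurableSet
  rw [setIntegral_congr_fun hm hkey, integral_const_mul]
  have ht : polarCoord.target = Ioi (0 : ℝ) ×ˢ Ioo (-Real.pi) Real.pi := rfl
  rw [ht, integral_add hAi (hBi.const_mul Complex.I), integral_const_mul, hAint, hBint]
  ring

/-- The Cauchy–Pompeiu formula for compactly supported functions. -/
lemma integral_wbar_div_sub {χ : ℂ → ℂ} (hχ : ContDiff ℝ 1 χ) (hc : HasCompactSupport χ) (η : ℂ) :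
    ∫ z, wbar χ z / (z - η) = -(Real.pi : ℂ) * χ η := by
  have h := integral_wbar_div_self (χ := fun z => χ (z + η))
    (hχ.comp (contDiff_id.add contDiff_const)) (hc.comp_homeomorph (Homeomorph.addRight η))
  rw [← integral_add_right_eq_self (fun z => wbar χ z / (z - η)) η]
  simpa [wbar, fderiv_comp_add_right] using h

lemma wz_eq_conj_wbar_conj {χ : ℂ → ℂ} (hχ : Differentiable ℝ χ) (z : ℂ) :
    wz χ z = (starRingEnd ℂ) (wbar (fun w => (starRingEnd ℂ) (χ w)) z) := by
  have h : fderiv ℝ (fun w => (starRingEnd ℂ) (χ w)) z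
      = (Complex.conjCLE : ℂ →L[ℝ] ℂ).comp (fderiv ℝ χ z) :=
    ((Complex.conjCLE : ℂ →L[ℝ] ℂ).hasFDerivAt.comp z (hχ z).hasFDerivAt).fderiv
  simp only [wz, wbar, h, ContinuousLinearMap.comp_apply, map_mul, map_add, Complex.conj_I,
    ContinuousLinearEquiv.coe_coe, Complex.conjCLE_apply, Complex.conj_conj, map_div₀, map_one,
    Complex.conj_ofNat]
  ring

lemma integral_wz_div_conj_sub {χ : ℂ → ℂ} (hχ : ContDiff ℝ 1 χ) (hc : HasCompactSupport χ)
    (ζ : ℂ) :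
    ∫ z, wz χ z / ((starRingEnd ℂ) z - (starRingEnd ℂ) ζ) = -(Real.pi : ℂ) * χ ζ := by
  have h := integral_wbar_div_sub (χ := fun z => (starRingEnd ℂ) (χ z))
    ((Complex.conjCLE : ℂ →L[ℝ] ℂ).contDiff.comp hχ)
    (hc.comp_left (g := (starRingEnd ℂ)) (map_zero _)) ζ
  have h2 := congrArg (starRingEnd ℂ) h
  rw [← integral_conj] at h2
  simpa [← wz_eq_conj_wbar_conj (hχ.differentiable one_ne_zero)] using h2

lemma wbar_holomorphic_mul {h χ : ℂ → ℂ} {z : ℂ} (hh : DifferentiableAt ℂ h z)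
    (hχ : DifferentiableAt ℝ χ z) : wbar (fun w => h w * χ w) z = h z * wbar χ z := by
  have h1 : HasFDerivAt h ((fderiv ℂ h z).restrictScalars ℝ) z :=
    hh.hasFDerivAt.restrictScalars ℝ
  have h2 := (h1.mul hχ.hasFDerivAt).fderiv
  have h3 : fderiv ℂ h z Complex.I = Complex.I * fderiv ℂ h z 1 := by
    rw [← smul_eq_mul, ← map_smul, smul_eq_mul, mul_one]
  have h4 : fderiv ℝ (fun w => h w * χ w) z = _ := h2
  simp only [wbar, h4, add_apply, smul_apply, smul_eq_mul,
    ContinuousLinearMap.coe_restrictScalars', h3]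
  linear_combination (1 / 2 * χ z * fderiv ℂ h z 1) * Complex.I_sq

lemma wz_conj_holomorphic_mul {h χ : ℂ → ℂ} (hh : Differentiable ℂ h) (hχ : Differentiable ℝ χ)
    (z : ℂ) : wz (fun w => (starRingEnd ℂ) (h w) * χ w) z = (starRingEnd ℂ) (h z) * wz χ z := by
  have hconj : Differentiable ℝ (starRingEnd ℂ) :=
    (Complex.conjCLE : ℂ →L[ℝ] ℂ).differentiable
  have hd : Differentiable ℝ fun w => (starRingEnd ℂ) (h w) * χ w :=
    (hconj.comp (hh.restrictScalars ℝ)).mul hχ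
  rw [wz_eq_conj_wbar_conj hd, wz_eq_conj_wbar_conj hχ]
  simp only [map_mul, Complex.conj_conj]
  have hd' : Differentiable ℝ fun w => (starRingEnd ℂ) (χ w) := hconj.comp hχ
  rw [wbar_holomorphic_mul (hh z) (hd' z), map_mul]

lemma contDiff_wz {φ : ℂ → ℂ} (hφ : ContDiff ℝ 2 φ) : ContDiff ℝ 1 (wz φ) := by
  have h : ContDiff ℝ 1 (fderiv ℝ φ) := hφ.fderiv_right le_rfl
  exact contDiff_const.mul ((h.clm_apply contDiff_const).sub
    (contDiff_const.mul (h.clm_apply contDiff_const)))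

lemma tsupport_wz_subset (φ : ℂ → ℂ) : tsupport (wz φ) ⊆ tsupport φ := by
  refine closure_minimal (fun z hz => ?_) (isClosed_tsupport φ)
  by_contra hn
  have h0 : fderiv ℝ φ z = 0 :=
    Function.notMem_support.1 fun h => hn (support_fderiv_subset ℝ h)
  exact hz (by simp [wz, h0])

lemma tsupport_wbar_subset (φ : ℂ → ℂ) : tsupport (wbar φ) ⊆ tsupport φ := by
  refine closure_minimal (fun z hz => ?_) (isClosed_tsupport φ)
  by_contra hn
  have h0 : fderiv ℝ φ z = 0 :=
    Function.notMem_support.1 fun h => hn (support_fderiv_subset ℝ h)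
  exact hz (by simp [wbar, h0])

/-- The Laplacian factors as `4 ∂_{z̄} ∂_z`. -/
lemma lap_eq_four_mul_wbar_wz {φ : ℂ → ℂ} (hφ : ContDiff ℝ 2 φ) (z : ℂ) :
    lap φ z = 4 * wbar (wz φ) z := by
  have h : ContDiff ℝ 1 (fderiv ℝ φ) := hφ.fderiv_right le_rfl
  have hd : HasFDerivAt (fderiv ℝ φ) (fderiv ℝ (fderiv ℝ φ) z) z :=
    (h.differentiable one_ne_zero z).hasFDerivAt
  have hv : ∀ v : ℂ, HasFDerivAt (fun w => fderiv ℝ φ w v)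
      ((ContinuousLinearMap.apply ℝ ℂ v).comp (fderiv ℝ (fderiv ℝ φ) z)) z := fun v =>
    (ContinuousLinearMap.apply ℝ ℂ v).hasFDerivAt.comp z hd
  have hsymm : fderiv ℝ (fderiv ℝ φ) z 1 Complex.I = fderiv ℝ (fderiv ℝ φ) z Complex.I 1 :=
    (hφ.contDiffAt.isSymmSndFDerivAt (by simp)) 1 Complex.I
  have hw : HasFDerivAt (wz φ) _ z :=
    ((hv 1).sub ((hv Complex.I).const_mul Complex.I)).const_mul (1 / 2 : ℂ)
  simp only [lap, wbar, hw.fderiv, (hv _).fderiv]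
  simp only [smul_apply, sub_apply,
    ContinuousLinearMap.comp_apply, ContinuousLinearMap.apply_apply, smul_eq_mul, hsymm]
  linear_combination (fderiv ℝ (fderiv ℝ φ) z Complex.I Complex.I) * Complex.I_sq

/-- A family of integrable functions with uniformly bounded `L¹` norms. -/
def IsBddKernel {α : Type*} [MeasurableSpace α] (ν : Measure α) (k : α → α → ℂ) : Prop :=
  AEStronglyMeasurable (Function.uncurry k) (ν.prod ν) ∧
    ∃ C : ℝ, ∀ᵐ η ∂ν, Integrable (k η) ν ∧ ∫ z, ‖k η z‖ ∂ν ≤ C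

lemma IsBddKernel.integrable {α : Type*} [MeasurableSpace α] {ν : Measure α} [IsFiniteMeasure ν]
    {k : α → α → ℂ} (hk : IsBddKernel ν k) : Integrable (Function.uncurry k) (ν.prod ν) := by
  obtain ⟨hm, C, hC⟩ := hk
  rw [integrable_prod_iff hm]
  refine ⟨hC.mono fun η h => h.1, ?_⟩
  refine Integrable.of_bound hm.norm.integral_prod_right' C (hC.mono fun η h => ?_)
  rw [Real.norm_of_nonneg (integral_nonneg fun _ => norm_nonneg _)]
  exact h.2

lemma IsBddKernel.mul_mul {α : Type*} [MeasurableSpace α] {ν : Measure α} [IsFiniteMeasure ν]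
    {k : α → α → ℂ} (hk : IsBddKernel ν k) {P Q : α → ℂ} {CP CQ : ℝ}
    (hP : AEStronglyMeasurable P ν) (hPb : ∀ᵐ x ∂ν, ‖P x‖ ≤ CP)
    (hQ : AEStronglyMeasurable Q ν) (hQb : ∀ᵐ x ∂ν, ‖Q x‖ ≤ CQ) :
    IsBddKernel ν (fun η z => P η * (Q z * k η z)) := by
  obtain ⟨hm, C, hC⟩ := hk
  refine ⟨hP.comp_fst.mul (hQ.comp_snd.mul hm), |CP| * (|CQ| * C), ?_⟩
  filter_upwards [hC, hPb] with η h hp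
  have hi : Integrable (fun z => Q z * k η z) ν := h.1.bdd_mul hQ hQb
  refine ⟨hi.const_mul _, ?_⟩
  simp_rw [norm_mul]
  rw [integral_const_mul]
  refine mul_le_mul (hp.trans (le_abs_self _)) ?_ (integral_nonneg fun _ => by positivity)
    (abs_nonneg _)
  calc ∫ z, ‖Q z‖ * ‖k η z‖ ∂ν ≤ ∫ z, |CQ| * ‖k η z‖ ∂ν := by
        refine integral_mono_ae ?_ (h.1.norm.const_mul _) ?_
        · simpa only [norm_mul] using hi.norm
        · filter_upwards [hQb] with z hz
          exact mul_le_mul_of_nonneg_right (hz.trans (le_abs_self _)) (norm_nonneg _)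
    _ ≤ |CQ| * C := by
        rw [integral_const_mul]
        exact mul_le_mul_of_nonneg_left h.2 (abs_nonneg _)

/-- Fubini's theorem for the composition of two bounded kernels. -/
lemma IsBddKernel.integral_integral_integral_mul {α : Type*} [MeasurableSpace α] {ν : Measure α}
    [IsFiniteMeasure ν] {k l : α → α → ℂ} (hk : IsBddKernel ν k) (hl : IsBddKernel ν l) :
    ∫ z, ∫ ζ, ∫ η, k η z * l η ζ ∂ν ∂ν ∂ν = ∫ η, (∫ z, k η z ∂ν) * ∫ ζ, l η ζ ∂ν ∂ν := by
  have hF : Integrable (Function.uncurry fun (η : α) (p : α × α) => k η p.1 * l η p.2)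
      (ν.prod (ν.prod ν)) := by
    obtain ⟨hkm, C, hC⟩ := hk
    obtain ⟨hlm, C', hC'⟩ := hl
    have hm : AEStronglyMeasurable (Function.uncurry fun (η : α) (p : α × α) =>
        k η p.1 * l η p.2) (ν.prod (ν.prod ν)) := by
      have q1 : Measure.QuasiMeasurePreserving (fun p : α × α × α => (p.1, p.2.1))
          (ν.prod (ν.prod ν)) (ν.prod ν) :=
        QuasiMeasurePreserving.prodMap (.id ν) Measure.quasiMeasurePreserving_fst
      have q2 : Measure.QuasiMeasurePreserving (fun p : α × α × α => (p.1, p.2.2))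
          (ν.prod (ν.prod ν)) (ν.prod ν) :=
        QuasiMeasurePreserving.prodMap (.id ν) Measure.quasiMeasurePreserving_snd
      exact (hkm.comp_quasiMeasurePreserving q1).mul (hlm.comp_quasiMeasurePreserving q2)
    rw [integrable_prod_iff hm]
    refine ⟨?_, ?_⟩
    · filter_upwards [hC, hC'] with η h h'
      exact h.1.mul_prod h'.1
    · refine Integrable.of_bound hm.norm.integral_prod_right' (|C| * C') ?_
      filter_upwards [hC, hC'] with η h h'
      rw [Real.norm_of_nonneg (integral_nonneg fun _ => norm_nonneg _)]
      simp only [Function.uncurry_apply_pair, norm_mul]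
      rw [integral_prod_mul (fun z => ‖k η z‖) (fun ζ => ‖l η ζ‖)]
      exact mul_le_mul (h.2.trans (le_abs_self _)) h'.2 (integral_nonneg fun _ => norm_nonneg _)
        (abs_nonneg _)
  have h1 := integral_integral_swap hF
  have h2 := integral_prod _ hF.integral_prod_right
  simp only [Function.uncurry_apply_pair] at h2
  rw [← h2, ← h1]
  exact integral_congr_ae (.of_forall fun η => integral_prod_mul (k η) (l η))

lemma integrableOn_inv_norm_ball (r : ℝ) :
    IntegrableOn (fun w : ℂ => ‖w‖⁻¹) (ball 0 r) := by
  have h := (integrableOn_fun_norm_addHaar (E := ℂ) volume (f := fun y : ℝ => y⁻¹) (r := r)).2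
  refine h ?_
  rw [Complex.finrank_real_complex]
  have h1 : IntegrableOn (fun _ : ℝ => (1 : ℝ)) (Set.Ioo 0 r) := by simp
  refine h1.congr_fun (fun y hy => ?_) measurableSet_Ioo
  simp [hy.1.ne']

lemma inv_norm_sub_ball_bound {R : ℝ} {η : ℂ} (hη : η ∈ ball (0 : ℂ) R) :
    IntegrableOn (fun z : ℂ => ‖z - η‖⁻¹) (ball 0 R) ∧
      ∫ z in ball (0 : ℂ) R, ‖z - η‖⁻¹ ≤ ∫ w in ball (0 : ℂ) (2 * R), ‖w‖⁻¹ := by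
  have hmp : MeasurePreserving (fun z : ℂ => z - η) volume volume :=
    measurePreserving_sub_right volume η
  have hemb : MeasurableEmbedding (fun z : ℂ => z - η) :=
    (MeasurableEquiv.subRight η).measurableEmbedding
  have hpre : (fun z : ℂ => z - η) ⁻¹' ball 0 (2 * R) = ball η (2 * R) := by
    ext z
    simp [dist_eq_norm]
  have hsub : ball (0 : ℂ) R ⊆ ball η (2 * R) := by
    refine ball_subset_ball' ?_
    rw [mem_ball, dist_comm] at hη
    linarith
  have hi : IntegrableOn (fun z : ℂ => ‖z - η‖⁻¹) (ball η (2 * R)) := by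
    have := (hmp.integrableOn_comp_preimage hemb).2 (integrableOn_inv_norm_ball (2 * R))
    rwa [hpre] at this
  refine ⟨hi.mono_set hsub, ?_⟩
  rw [← hmp.setIntegral_preimage_emb hemb (fun w => ‖w‖⁻¹), hpre]
  exact setIntegral_mono_set hi (.of_forall fun _ => by positivity) hsub.eventuallyLE

lemma isBddKernel_inv_sub (R : ℝ) :
    IsBddKernel (volume.restrict (ball (0 : ℂ) R)) fun η z => (z - η)⁻¹ := by
  refine ⟨(measurable_snd.sub measurable_fst).inv.aestronglyMeasurable,
    ∫ w in ball (0 : ℂ) (2 * R), ‖w‖⁻¹, ?_⟩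
  filter_upwards [ae_restrict_mem measurableSet_ball] with η hη
  obtain ⟨h1, h2⟩ := inv_norm_sub_ball_bound hη
  refine ⟨?_, by simpa only [norm_inv] using h2⟩
  refine (integrable_norm_iff ?_).1 (by simpa only [norm_inv, IntegrableOn] using h1)
  exact (measurable_id.sub_const η).inv.aestronglyMeasurable

lemma isBddKernel_inv_conj_sub (R : ℝ) :
    IsBddKernel (volume.restrict (ball (0 : ℂ) R))
      fun η ζ => ((starRingEnd ℂ) η - (starRingEnd ℂ) ζ)⁻¹ := by
  have hc : Measurable (starRingEnd ℂ) := Complex.continuous_conj.measurable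
  have hn : ∀ η ζ : ℂ, ‖((starRingEnd ℂ) η - (starRingEnd ℂ) ζ)⁻¹‖ = ‖ζ - η‖⁻¹ := fun η ζ => by
    rw [norm_inv, ← map_sub, Complex.norm_conj, norm_sub_rev]
  refine ⟨((hc.comp measurable_fst).sub (hc.comp measurable_snd)).inv.aestronglyMeasurable,
    ∫ w in ball (0 : ℂ) (2 * R), ‖w‖⁻¹, ?_⟩
  filter_upwards [ae_restrict_mem measurableSet_ball] with η hη
  obtain ⟨h1, h2⟩ := inv_norm_sub_ball_bound hη
  refine ⟨?_, by simpa only [hn] using h2⟩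
  refine (integrable_norm_iff ?_).1 (by simpa only [hn, IntegrableOn] using h1)
  exact (hc.const_sub _).inv.aestronglyMeasurable

lemma integral_wbar_eq_zero {χ : ℂ → ℂ} (hχ : ContDiff ℝ 1 χ) (hc : HasCompactSupport χ) :
    ∫ z, wbar χ z = 0 := by
  have h := integral_wbar_div_self (χ := fun z => z * χ z) (contDiff_id.mul hχ) hc.mul_left
  rw [zero_mul, mul_zero] at h
  rw [← h]
  have h0 : ∀ᵐ z : ℂ, z ≠ 0 := Measure.ae_ne volume 0
  refine integral_congr_ae ?_
  filter_upwards [h0] with z hz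
  rw [wbar_holomorphic_mul (h := fun w => w) differentiableAt_id
    (hχ.differentiable one_ne_zero z), mul_div_cancel_left₀ _ hz]

theorem statement13 (R : ℝ) (hR : 0 < R) (v : ℂ → ℂ)
    (hvc : ContinuousOn v (closedBall (0:ℂ) R))
    (hvb : ∃ M : ℝ, ∀ z ∈ closedBall (0:ℂ) R, ‖v z‖ ≤ M)
    (z0 lam : ℂ) (μ : ℂ → ℂ)
    (hμc : ContinuousOn μ (closedBall (0:ℂ) R))
    (hμb : ∃ M : ℝ, ∀ z ∈ closedBall (0:ℂ) R, ‖μ z‖ ≤ M)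
    (hfix : ∀ z ∈ closedBall (0:ℂ) R, μ z = 1 + gop R z0 lam (fun ζ => v ζ * μ ζ) z) :
    ∀ φ : ℂ → ℂ, ContDiff ℝ (⊤ : ℕ∞) φ → HasCompactSupport φ → tsupport φ ⊆ ball (0:ℂ) R →
      ∫ z in ball (0:ℂ) R, (Complex.exp (lam * (z - z0) ^ 2) * μ z) * lap φ z =
        ∫ z in ball (0:ℂ) R, v z * (Complex.exp (lam * (z - z0) ^ 2) * μ z) * φ z := by
  intro φ hφ hφc hφs
  have hφ2 : ContDiff ℝ 2 φ := hφ.of_le (WithTop.coe_le_coe.2 le_top)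
  set ν : Measure ℂ := volume.restrict (ball (0 : ℂ) R)
  have : IsFiniteMeasure ν := isFiniteMeasure_restrict.2 measure_ball_lt_top.ne
  set a : ℂ → ℂ := fun z => Complex.exp (lam * (z - z0) ^ 2) with ha
  set E : ℂ → ℂ := fun ζ => Complex.exp (lam * (ζ - z0) ^ 2
    - (starRingEnd ℂ) lam * ((starRingEnd ℂ) (ζ - z0)) ^ 2) with hE
  set F : ℂ → ℂ := fun η => Complex.exp (-(lam * (η - z0) ^ 2)
    + (starRingEnd ℂ) lam * ((starRingEnd ℂ) (η - z0)) ^ 2) with hF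
  have haC : ContDiff ℂ 1 a := by fun_prop
  have haR : ContDiff ℝ 1 a := haC.restrict_scalars ℝ
  have hconjC : Continuous (starRingEnd ℂ) := Complex.continuous_conj
  have hEc : Continuous E := by fun_prop
  have hFc : Continuous F := by fun_prop
  have hFa : ∀ η, F η * a η = (starRingEnd ℂ) (a η) := fun η => by
    simp only [hF, ha]
    rw [← Complex.exp_add, ← Complex.exp_conj]
    congr 1
    simp only [map_mul, map_pow]
    ring
  have hEa : ∀ η, E η * (starRingEnd ℂ) (a η) = a η := fun η => by
    simp only [hE, ha]
    rw [← Complex.exp_conj, ← Complex.exp_add]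
    congr 1
    simp only [map_mul, map_pow]
    ring
  -- bounded functions on the disc
  have hbdd : ∀ u : ℂ → ℂ, ContinuousOn u (closedBall (0 : ℂ) R) →
      AEStronglyMeasurable u ν ∧ ∃ C : ℝ, ∀ᵐ z ∂ν, ‖u z‖ ≤ C := fun u hu => by
    refine ⟨(hu.mono ball_subset_closedBall).aestronglyMeasurable measurableSet_ball, ?_⟩
    obtain ⟨C, hC⟩ := (isCompact_closedBall (0 : ℂ) R).exists_bound_of_continuousOn hu
    refine ⟨C, ?_⟩
    filter_upwards [ae_restrict_mem measurableSet_ball] with z hz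
    exact hC z (ball_subset_closedBall hz)
  have hint : ∀ u : ℂ → ℂ, ContinuousOn u (closedBall (0 : ℂ) R) → Integrable u ν := fun u hu => by
    obtain ⟨h1, C, h2⟩ := hbdd u hu
    exact Integrable.of_bound h1 C h2
  have hfull : ∀ χ G : ℂ → ℂ, tsupport χ ⊆ ball (0 : ℂ) R →
      ∫ z, χ z * G z ∂ν = ∫ z, χ z * G z := fun χ G hs => by
    refine setIntegral_eq_integral_of_forall_compl_eq_zero fun z hz => ?_
    rw [image_eq_zero_of_notMem_tsupport fun h => hz (hs h), zero_mul]
  -- the two test functions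
  have hwz1 : ContDiff ℝ 1 (wz φ) := contDiff_wz hφ2
  have hwzc : HasCompactSupport (wz φ) :=
    hφc.of_isClosed_subset (isClosed_tsupport _) (tsupport_wz_subset φ)
  set χ : ℂ → ℂ := fun z => (4 * a z) * wz φ z with hχdef
  have hχ1 : ContDiff ℝ 1 χ := (contDiff_const.mul haR).mul hwz1
  have hχc : HasCompactSupport χ := hwzc.mul_left
  have hχs : tsupport (wbar χ) ⊆ ball (0 : ℂ) R :=
    (tsupport_wbar_subset χ).trans <| (tsupport_mul_subset_right).trans <|
      (tsupport_wz_subset φ).trans hφs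
  have hχ : ∀ z, wbar χ z = a z * lap φ z := fun z => by
    rw [hχdef, wbar_holomorphic_mul (h := fun z => 4 * a z)
      ((haC.differentiable one_ne_zero z).const_mul 4) (hwz1.differentiable one_ne_zero z),
      lap_eq_four_mul_wbar_wz hφ2]
    ring
  have hχcont : Continuous (wbar χ) := by
    have h := hχ1.continuous_fderiv one_ne_zero
    unfold wbar
    fun_prop
  set θ : ℂ → ℂ := fun z => (starRingEnd ℂ) (a z) * φ z with hθdef
  have hθ1 : ContDiff ℝ 1 θ :=
    ((Complex.conjCLE : ℂ →L[ℝ] ℂ).contDiff.comp haR).mul (hφ2.of_le (by norm_num))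
  have hθc : HasCompactSupport θ := hφc.mul_left
  have hθs : tsupport (wz θ) ⊆ ball (0 : ℂ) R :=
    (tsupport_wz_subset θ).trans <| (tsupport_mul_subset_right).trans hφs
  have hθ : ∀ z, wz θ z = (starRingEnd ℂ) (a z) * wz φ z := fun z =>
    wz_conj_holomorphic_mul (haC.differentiable one_ne_zero) (hφ2.differentiable two_ne_zero) z
  have hθcont : Continuous (wz θ) := by
    have h := hθ1.continuous_fderiv one_ne_zero
    unfold wz
    fun_prop
  -- the Green operator tested against `a * Δφ`
  set B : ℂ → ℂ := fun ζ => E ζ * (v ζ * μ ζ) / (4 * (Real.pi : ℂ) ^ 2) with hB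
  have hBc : ContinuousOn B (closedBall (0 : ℂ) R) :=
    (hEc.continuousOn.mul (hvc.mul hμc)).div_const _
  obtain ⟨hχm, Cχ, hχb⟩ := hbdd _ hχcont.continuousOn
  obtain ⟨hFm, CF, hFb⟩ := hbdd _ hFc.continuousOn
  obtain ⟨hBm, CB, hBb⟩ := hbdd _ hBc
  obtain ⟨hθm, Cθ, hθb⟩ := hbdd _ hθcont.continuousOn
  have hone : ∀ᵐ z : ℂ ∂ν, ‖(1 : ℂ)‖ ≤ 1 := .of_forall fun _ => by simp
  have hk := (isBddKernel_inv_sub R).mul_mul hFm hFb hχm hχb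
  have hl := (isBddKernel_inv_conj_sub R).mul_mul aestronglyMeasurable_const hone hBm hBb
  have hl' := (isBddKernel_inv_conj_sub R).mul_mul hθm hθb hBm hBb
  have hpi : (Real.pi : ℂ) ≠ 0 := by exact_mod_cast Real.pi_ne_zero
  have hgop : ∫ z, wbar χ z * gop R z0 lam (fun ζ => v ζ * μ ζ) z ∂ν
      = ∫ z, v z * (a z * μ z) * φ z ∂ν := by
    calc ∫ z, wbar χ z * gop R z0 lam (fun ζ => v ζ * μ ζ) z ∂ν
        = ∫ z, ∫ ζ, ∫ η, (F η * (wbar χ z * (z - η)⁻¹)) *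
            (1 * (B ζ * ((starRingEnd ℂ) η - (starRingEnd ℂ) ζ)⁻¹)) ∂ν ∂ν ∂ν := by
          refine integral_congr_ae (.of_forall fun z => ?_)
          simp only [gop, gker]
          rw [← integral_const_mul]
          refine integral_congr_ae (.of_forall fun ζ => ?_)
          simp only []
          rw [← integral_const_mul, ← integral_mul_const, ← integral_const_mul]
          refine integral_congr_ae (.of_forall fun η => ?_)
          simp only [hB, hE, hF, div_eq_mul_inv, mul_inv]
          ring
      _ = ∫ η, (∫ z, F η * (wbar χ z * (z - η)⁻¹) ∂ν) *
            ∫ ζ, 1 * (B ζ * ((starRingEnd ℂ) η - (starRingEnd ℂ) ζ)⁻¹) ∂ν ∂ν :=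
          hk.integral_integral_integral_mul hl
      _ = ∫ η, ∫ ζ, (-(4 * Real.pi : ℂ)) *
            (wz θ η * (B ζ * ((starRingEnd ℂ) η - (starRingEnd ℂ) ζ)⁻¹)) ∂ν ∂ν := by
          refine integral_congr_ae (.of_forall fun η => ?_)
          simp only []
          rw [integral_const_mul, hfull _ _ hχs]
          simp only [← div_eq_mul_inv]
          rw [integral_wbar_div_sub hχ1 hχc, ← integral_const_mul]
          refine integral_congr_ae (.of_forall fun ζ => ?_)
          simp only [hθ, ← hFa, hχdef]
          ring
      _ = ∫ ζ, ∫ η, (-(4 * Real.pi : ℂ)) *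
            (wz θ η * (B ζ * ((starRingEnd ℂ) η - (starRingEnd ℂ) ζ)⁻¹)) ∂ν ∂ν :=
          integral_integral_swap (hl'.integrable.const_mul _)
      _ = ∫ z, v z * (a z * μ z) * φ z ∂ν := by
          refine integral_congr_ae (.of_forall fun ζ => ?_)
          have h1 : ∀ η, wz θ η * (B ζ * ((starRingEnd ℂ) η - (starRingEnd ℂ) ζ)⁻¹)
              = B ζ * (wz θ η * ((starRingEnd ℂ) η - (starRingEnd ℂ) ζ)⁻¹) := fun η => by ring
          simp only [h1]
          rw [integral_const_mul, integral_const_mul, hfull _ _ hθs]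
          simp only [← div_eq_mul_inv]
          rw [integral_wz_div_conj_sub hθ1 hθc]
          simp only [hB, hθdef]
          field_simp
          linear_combination (v ζ * μ ζ * φ ζ) * hEa ζ
  have hfree : ∫ z, wbar χ z ∂ν = 0 := by
    have h := hfull (wbar χ) (fun _ => 1) hχs
    simpa only [mul_one, integral_wbar_eq_zero hχ1 hχc] using h
  rw [← hgop, ← sub_zero (∫ z, _ ∂ν), ← hfree, ← integral_sub]
  · refine integral_congr_ae ?_
    filter_upwards [ae_restrict_mem measurableSet_ball] with z hz
    rw [hfix z (ball_subset_closedBall hz), hχ]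
    simp only [ha]
    ring
  · refine (hint (fun z => μ z * wbar χ z) (hμc.mul hχcont.continuousOn)).congr
      (.of_forall fun z => ?_)
    simp only [hχ, ha]
    ring
  · exact hint _ hχcont.continuousOn
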